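/- Suppose the dynamical system (X,T,μ) satisfies the polynomial concentration inequality with moment q ≥ 2 and constant C_q > 0. Then there exists a constant D_q > 0, depending only on the system, the noise and q, such that for every ε > 0, every n ≥ 1, and every separately Lipschitz K : (ℝ^d)^n → ℝ, the observed system satisfies E_{μ_n ⊗ P^n}[|K(y_0,…,y_{n−1}) − E_{μ_n ⊗ P^n}[K(y_0,…,y_{n−1})]|^q] ≤ D_q (1 + ε)^q (Σ_{j=0}^{n−1} Lip_j(K)²)^{q/2}. -/

import Mathlib

open MeasureTheory Real

noncomputable section

/-- `K` is separately Lipschitz in each of its `n` variables, with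
`L j` a Lipschitz constant for the `j`-th variable. -/
def SepLip {E : Type*} [PseudoMetricSpace E] {n : ℕ}
    (K : (Fin n → E) → ℝ) (L : Fin n → ℝ) : Prop :=
  ∀ (x : Fin n → E) (j : Fin n) (y : E),
    |K x - K (Function.update x j y)| ≤ L j * dist (x j) y

lemma tele_bound {α : Type*} {n : ℕ} (f : (Fin n → α) → ℝ) (D : Fin n → α → α → ℝ)
    (h : ∀ x j y, |f x - f (Function.update x j y)| ≤ D j (x j) y) (x y : Fin n → α) :
    |f x - f y| ≤ ∑ j, D j (x j) (y j) := by
  have key : ∀ s : Finset (Fin n), |f x - f (s.piecewise y x)| ≤ ∑ j ∈ s, D j (x j) (y j) := by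
    intro s
    induction s using Finset.induction_on with
    | empty => simp
    | insert j s hj ih =>
      rw [Finset.piecewise_insert, Finset.sum_insert hj]
      have h1 := h (s.piecewise y x) j (y j)
      rw [Finset.piecewise_eq_of_notMem _ _ _ hj] at h1
      have := abs_sub_le (f x) (f (s.piecewise y x)) (f (Function.update (s.piecewise y x) j (y j)))
      linarith
  have := key Finset.univ
  simpa using this

lemma bdd_of_diff {α : Type*} [Nonempty α] {n : ℕ} (f : (Fin n → α) → ℝ) (c : Fin n → ℝ)
    (h : ∀ x j y, |f x - f (Function.update x j y)| ≤ c j) : ∃ M, ∀ x, |f x| ≤ M := by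
  obtain ⟨a⟩ := ‹Nonempty α›
  refine ⟨|f (fun _ => a)| + ∑ j, c j, fun x => ?_⟩
  have h1 := tele_bound f (fun j _ _ => c j) h x (fun _ => a)
  have h2 := abs_sub_abs_le_abs_sub (f x) (f (fun _ => a))
  linarith

lemma hoeffding_one {α : Type*} [MeasurableSpace α] (ν : Measure α) [IsProbabilityMeasure ν]
    (f : α → ℝ) (hf : Measurable f) (c : ℝ) (h : ∀ x y, |f x - f y| ≤ c) :
    ∫ x, exp (f x - ∫ z, f z ∂ν) ∂ν ≤ exp (c ^ 2 / 2) := by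
  obtain ⟨a⟩ := nonempty_of_isProbabilityMeasure ν
  have h1 := ProbabilityTheory.hasSubgaussianMGF_of_mem_Icc (μ := ν) (X := f) (a := f a - c)
    (b := f a + c) hf.aemeasurable (Filter.Eventually.of_forall fun x => by
      have := abs_le.1 (h x a)
      constructor <;> linarith)
  have h2 := h1.mgf_le 1
  have e : (f a + c - (f a - c)) = 2 * c := by ring
  simp only [ProbabilityTheory.mgf, one_mul, e] at h2
  refine h2.trans (le_of_eq ?_)
  congr 1
  push_cast
  rw [norm_mul, Real.norm_eq_abs, Real.norm_eq_abs, abs_of_pos (by norm_num : (0:ℝ) < 2)]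
  rw [mul_div_cancel_left₀ _ (by norm_num : (2:ℝ) ≠ 0), sq_abs]
  ring

lemma mgf_bdd_diff {α : Type*} [MeasurableSpace α] (ν : Measure α) [IsProbabilityMeasure ν]
    (n : ℕ) : ∀ (f : (Fin n → α) → ℝ) (c : Fin n → ℝ), Measurable f →
    (∀ x j y, |f x - f (Function.update x j y)| ≤ c j) →
    ∫ x, exp (f x - ∫ z, f z ∂(Measure.pi fun _ : Fin n => ν)) ∂(Measure.pi fun _ : Fin n => ν)
      ≤ exp ((∑ j, c j ^ 2) / 2) := by
  induction n with
  | zero =>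
    intro f c hf h
    have : ∀ x, f x = f default := fun x => by rw [Subsingleton.elim x default]
    simp [this]
  | succ n ih =>
    intro f c hf h
    have := nonempty_of_isProbabilityMeasure ν
    obtain ⟨M, hM⟩ := bdd_of_diff f c h
    set ρ := Measure.pi fun _ : Fin n => ν with hρ
    have hmp := (measurePreserving_piFinSuccAbove (fun _ : Fin (n+1) => ν) 0).symm
    have tr : ∀ g : (Fin (n+1) → α) → ℝ, ∫ x, g x ∂(Measure.pi fun _ : Fin (n+1) => ν)
        = ∫ p, g (Fin.cons p.1 p.2) ∂(ν.prod ρ) := by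
      intro g
      rw [← hmp.integral_comp']
      simp [MeasurableEquiv.piFinSuccAbove_symm_apply, Fin.insertNthEquiv, hρ]
    have hcm : Measurable (fun p : α × (Fin n → α) => (Fin.cons p.1 p.2 : Fin (n+1) → α)) := by
      refine measurable_pi_iff.2 fun j => ?_
      refine Fin.cases ?_ (fun j => ?_) j
      · simpa using measurable_fst
      · simp only [Fin.cons_succ]; fun_prop
    have hF : Measurable (fun p : α × (Fin n → α) => f (Fin.cons p.1 p.2)) := hf.comp hcm
    set g : (Fin n → α) → ℝ := fun x => ∫ a, f (Fin.cons a x) ∂ν with hg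
    have hgm : Measurable g := (hF.stronglyMeasurable.integral_prod_left' (μ := ν)).measurable
    have hFi : Integrable (fun p : α × (Fin n → α) => f (Fin.cons p.1 p.2)) (ν.prod ρ) :=
      Integrable.of_bound hF.aestronglyMeasurable M (Filter.Eventually.of_forall fun p => hM _)
    have hfx : ∀ x : Fin n → α, Measurable (fun a => f (Fin.cons a x)) := fun x =>
      hF.comp (measurable_id.prodMk measurable_const)
    have hfi : ∀ x : Fin n → α, Integrable (fun a => f (Fin.cons a x)) ν := fun x =>
      Integrable.of_bound (hfx x).aestronglyMeasurable M (Filter.Eventually.of_forall fun p => hM _)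
    have hEg : ∫ z, f z ∂(Measure.pi fun _ : Fin (n+1) => ν) = ∫ x, g x ∂ρ := by
      rw [tr, integral_prod_symm _ hFi]
    have hgM : ∀ x, |g x| ≤ M := fun x => by
      have := norm_integral_le_of_norm_le_const (μ := ν) (f := fun a => f (Fin.cons a x)) (C := M)
        (Filter.Eventually.of_forall fun p => hM _)
      simpa using this
    have hgd : ∀ x j y, |g x - g (Function.update x j y)| ≤ c j.succ := by
      intro x j y
      simp only [hg]
      rw [← integral_sub (hfi _) (hfi _)]
      have := norm_integral_le_of_norm_le_const (μ := ν)
        (f := fun a => f (Fin.cons a x) - f (Fin.cons a (Function.update x j y))) (C := c j.succ)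
        (Filter.Eventually.of_forall fun a => by
          rw [Fin.cons_update]
          exact h _ _ _)
      simpa using this
    have ihg := ih g (fun j => c j.succ) hgm hgd
    rw [hEg, tr, integral_prod_symm]
    · have step : ∀ x : Fin n → α, ∫ a, exp (f (Fin.cons a x) - ∫ x, g x ∂ρ) ∂ν
          ≤ exp (c 0 ^ 2 / 2) * exp (g x - ∫ x, g x ∂ρ) := by
        intro x
        have h1 := hoeffding_one ν (fun a => f (Fin.cons a x)) (hfx x) (c 0) (fun a b => by
          have := h (Fin.cons a x) 0 b
          rwa [Fin.update_cons_zero] at this)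
        have : ∀ a, exp (f (Fin.cons a x) - ∫ x, g x ∂ρ)
            = exp (f (Fin.cons a x) - g x) * exp (g x - ∫ x, g x ∂ρ) := by
          intro a; rw [← exp_add]; congr 1; ring
        simp_rw [this]
        rw [integral_mul_const]
        exact mul_le_mul_of_nonneg_right h1 (exp_pos _).le
      have hei : Integrable (fun x => exp (g x - ∫ x, g x ∂ρ)) ρ := by
        refine Integrable.of_bound (by fun_prop) (exp (M - ∫ x, g x ∂ρ))
          (Filter.Eventually.of_forall fun x => ?_)
        rw [Real.norm_eq_abs, abs_exp, exp_le_exp]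
        linarith [(abs_le.1 (hgM x)).2]
      calc _ ≤ ∫ x, exp (c 0 ^ 2 / 2) * exp (g x - ∫ x, g x ∂ρ) ∂ρ :=
            integral_mono_of_nonneg (Filter.Eventually.of_forall fun x =>
              integral_nonneg fun a => (exp_pos _).le) (hei.const_mul _)
              (Filter.Eventually.of_forall step)
        _ ≤ exp (c 0 ^ 2 / 2) * exp ((∑ j : Fin n, c j.succ ^ 2) / 2) := by
            rw [integral_const_mul]
            exact mul_le_mul_of_nonneg_left ihg (exp_pos _).le
        _ = _ := by
            rw [← exp_add, Fin.sum_univ_succ]; congr 1; ring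
    · refine Integrable.of_bound (hF.sub_const _).exp.aestronglyMeasurable (exp (M - ∫ x, g x ∂ρ))
        (Filter.Eventually.of_forall fun x => ?_)
      rw [Real.norm_eq_abs, abs_exp, exp_le_exp]
      linarith [(abs_le.1 (hM (Fin.cons x.1 x.2))).2]

lemma rpow_le_exp (q : ℝ) (hq : 0 < q) (t : ℝ) :
    |t| ^ q ≤ q ^ q * (exp t + exp (-t)) := by
  have h1 : |t| / q ≤ exp (|t| / q) := by linarith [add_one_le_exp (|t| / q)]
  have h2 : (|t| / q) ^ q ≤ exp |t| := by
    refine (rpow_le_rpow (by positivity) h1 hq.le).trans (le_of_eq ?_)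
    rw [← exp_mul]; congr 1; field_simp
  have h3 : |t| ^ q = q ^ q * (|t| / q) ^ q := by
    rw [← mul_rpow hq.le (by positivity)]; congr 1; field_simp
  rw [h3]
  refine mul_le_mul_of_nonneg_left (h2.trans ?_) (by positivity)
  rcases abs_choice t with h | h <;> rw [h]
  · linarith [exp_pos (-t)]
  · linarith [exp_pos t]

lemma moment_unit {α : Type*} [MeasurableSpace α] (ν : Measure α) [IsProbabilityMeasure ν]
    (q : ℝ) (hq : 0 < q) (n : ℕ) (f : (Fin n → α) → ℝ) (c : Fin n → ℝ) (hf : Measurable f)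
    (h : ∀ x j y, |f x - f (Function.update x j y)| ≤ c j) (hc : ∑ j, c j ^ 2 ≤ 1) :
    ∫ x, |f x - ∫ z, f z ∂(Measure.pi fun _ : Fin n => ν)| ^ q ∂(Measure.pi fun _ : Fin n => ν)
      ≤ q ^ q * (2 * exp (1 / 2)) := by
  have := nonempty_of_isProbabilityMeasure ν
  obtain ⟨M, hM⟩ := bdd_of_diff f c h
  set ρ := Measure.pi fun _ : Fin n => ν with hρ
  have h1 := mgf_bdd_diff ν n f c hf h
  have h2 := mgf_bdd_diff ν n (fun x => - f x) c hf.neg (fun x j y => by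
    rw [← abs_neg]; simpa [neg_add_eq_sub, abs_sub_comm] using h x j y)
  rw [← hρ] at h1 h2
  rw [integral_neg] at h2
  have hexp : exp ((∑ j, c j ^ 2) / 2) ≤ exp (1 / 2) := exp_le_exp.2 (by linarith)
  have i1 : Integrable (fun x => exp (f x - ∫ z, f z ∂ρ)) ρ := by
    refine Integrable.of_bound (by fun_prop) (exp (M - ∫ x, f x ∂ρ))
      (Filter.Eventually.of_forall fun x => ?_)
    rw [Real.norm_eq_abs, abs_exp, exp_le_exp]
    linarith [(abs_le.1 (hM x)).2]
  have i2 : Integrable (fun x => exp (-(f x - ∫ z, f z ∂ρ))) ρ := by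
    refine Integrable.of_bound (by fun_prop) (exp (M + ∫ x, f x ∂ρ))
      (Filter.Eventually.of_forall fun x => ?_)
    rw [Real.norm_eq_abs, abs_exp, exp_le_exp]
    linarith [(abs_le.1 (hM x)).1]
  calc _ ≤ ∫ x, q ^ q * (exp (f x - ∫ z, f z ∂ρ) + exp (-(f x - ∫ z, f z ∂ρ))) ∂ρ :=
        integral_mono_of_nonneg (Filter.Eventually.of_forall fun x => by positivity)
          ((i1.add i2).const_mul _) (Filter.Eventually.of_forall fun x => rpow_le_exp q hq _)
    _ ≤ _ := by
      rw [integral_const_mul, integral_add i1 i2]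
      refine mul_le_mul_of_nonneg_left ?_ (by positivity)
      have e : ∀ x, -(f x - ∫ z, f z ∂ρ) = -f x - -∫ z, f z ∂ρ := fun x => by ring
      simp_rw [e]
      linarith

lemma moment_bdd_diff {α : Type*} [MeasurableSpace α] (ν : Measure α) [IsProbabilityMeasure ν]
    (q : ℝ) (hq : 0 < q) (n : ℕ) (f : (Fin n → α) → ℝ) (c : Fin n → ℝ) (hf : Measurable f)
    (h : ∀ x j y, |f x - f (Function.update x j y)| ≤ c j) :
    ∫ x, |f x - ∫ z, f z ∂(Measure.pi fun _ : Fin n => ν)| ^ q ∂(Measure.pi fun _ : Fin n => ν)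
      ≤ q ^ q * (2 * exp (1 / 2)) * (∑ j, c j ^ 2) ^ (q / 2) := by
  set S := ∑ j, c j ^ 2 with hS
  have hS0 : 0 ≤ S := Finset.sum_nonneg fun j _ => sq_nonneg _
  set B := q ^ q * (2 * exp (1 / 2)) with hB
  have key : ∀ s, S < s →
      ∫ x, |f x - ∫ z, f z ∂(Measure.pi fun _ : Fin n => ν)| ^ q
        ∂(Measure.pi fun _ : Fin n => ν) ≤ B * s ^ (q / 2) := by
    intro s hs
    have s0 : 0 < s := hS0.trans_lt hs
    have r0 : 0 < √s := sqrt_pos.2 s0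
    have h1 := moment_unit ν q hq n (fun x => f x / √s) (fun j => c j / √s) (hf.div_const _)
      (fun x j y => by
        rw [← sub_div, abs_div, abs_of_pos r0]
        exact div_le_div_of_nonneg_right (h x j y) r0.le)
      (by
        simp_rw [div_pow, sq_sqrt s0.le]
        rw [← Finset.sum_div, div_le_one s0]
        exact hs.le)
    rw [integral_div] at h1
    simp_rw [← sub_div, abs_div, abs_of_pos r0, div_rpow (abs_nonneg _) r0.le] at h1
    rw [integral_div, div_le_iff₀ (by positivity)] at h1
    have e : √s ^ q = s ^ (q / 2) := by
      rw [sqrt_eq_rpow, ← rpow_mul s0.le]; congr 1; ring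
    rwa [e] at h1
  have hcont : Filter.Tendsto (fun s : ℝ => B * s ^ (q / 2)) (nhdsWithin S (Set.Ioi S))
      (nhds (B * S ^ (q / 2))) := by
    have : ContinuousAt (fun s : ℝ => B * s ^ (q / 2)) S :=
      continuousAt_const.mul (continuousAt_rpow_const _ _ (Or.inr (by positivity)))
    exact this.tendsto.mono_left nhdsWithin_le_nhds
  exact ge_of_tendsto hcont (by filter_upwards [self_mem_nhdsWithin] with s hs using key s hs)

lemma SepLip.abs {E : Type*} [PseudoMetricSpace E] {n : ℕ} {K : (Fin n → E) → ℝ} {L : Fin n → ℝ}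
    (h : SepLip K L) : SepLip K (fun j => |L j|) := fun x j y =>
  (h x j y).trans (mul_le_mul_of_nonneg_right (le_abs_self _) dist_nonneg)

lemma SepLip.continuous {E : Type*} [PseudoMetricSpace E] {n : ℕ} {K : (Fin n → E) → ℝ}
    {L : Fin n → ℝ} (h : SepLip K L) : Continuous K := by
  rw [continuous_iff_continuousAt]
  intro x
  have hb : ∀ y, dist (K y) (K x) ≤ ∑ j, L j * dist (y j) (x j) := fun y =>
    tele_bound K (fun j a b => L j * dist a b) h y x
  have ht : Filter.Tendsto (fun y : Fin n → E => ∑ j, L j * dist (y j) (x j)) (nhds x) (nhds 0) := by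
    have hc : Continuous (fun y : Fin n → E => ∑ j, L j * dist (y j) (x j)) := by fun_prop
    have := hc.tendsto x
    simpa using this
  exact tendsto_iff_dist_tendsto_zero.2 (squeeze_zero (fun _ => dist_nonneg) hb ht)

/-- Truncation of the noise to the unit ball. -/
def truncB {V : Type*} [NormedAddCommGroup V] (v : V) : V :=
  open Classical in if ‖v‖ ≤ 1 then v else 0

lemma truncB_norm {V : Type*} [NormedAddCommGroup V] (v : V) : ‖truncB v‖ ≤ 1 := by
  unfold truncB; split_ifs with h
  · exact h
  · simp

lemma truncB_meas {V : Type*} [NormedAddCommGroup V] [MeasurableSpace V] [BorelSpace V] :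
    Measurable (truncB : V → V) := by
  unfold truncB
  exact Measurable.ite (measurableSet_le measurable_norm measurable_const) measurable_id
    measurable_const

theorem core {d : ℕ}
    (X : Set (EuclideanSpace ℝ (Fin d))) (hX : IsCompact X)
    (T : EuclideanSpace ℝ (Fin d) → EuclideanSpace ℝ (Fin d))
    (hT : Measurable T) (hTX : Set.MapsTo T X X)
    (μ : Measure (EuclideanSpace ℝ (Fin d))) [IsProbabilityMeasure μ]
    (hμX : μ X = 1)
    (q : ℝ) (hq : 2 ≤ q) (Cq : ℝ)
    (hconc : ∀ (n : ℕ), 1 ≤ n → ∀ (K : (Fin n → EuclideanSpace ℝ (Fin d)) → ℝ)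
      (L : Fin n → ℝ), SepLip K L →
      ∫ x, |K (fun i => T^[(i : ℕ)] x)
          - ∫ z, K (fun i => T^[(i : ℕ)] z) ∂μ| ^ q ∂μ
        ≤ Cq * (∑ j, L j ^ 2) ^ (q / 2))
    (P : Measure (EuclideanSpace ℝ (Fin d))) [IsProbabilityMeasure P]
    (ε : ℝ) (hε : 0 < ε) (n : ℕ) (hn : 1 ≤ n)
    (K : (Fin n → EuclideanSpace ℝ (Fin d)) → ℝ) (L : Fin n → ℝ) (hK : SepLip K L)
    (hL : ∀ j, 0 ≤ L j) :
      ∫ p, |K (fun i => T^[(i : ℕ)] p.1 + ε • truncB (p.2 i))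
          - ∫ p', K (fun i => T^[(i : ℕ)] p'.1 + ε • truncB (p'.2 i))
              ∂(μ.prod (Measure.pi fun _ : Fin n => P))| ^ q
        ∂(μ.prod (Measure.pi fun _ : Fin n => P))
        ≤ 2 ^ q * (q ^ q * (2 * exp (1 / 2)) * (∑ j, (2 * ε * L j) ^ 2) ^ (q / 2)
            + Cq * (∑ j, L j ^ 2) ^ (q / 2)) := by
  have q0 : 0 < q := by linarith
  set ρ := Measure.pi fun _ : Fin n => P with hρ
  have hKm : Measurable K := hK.continuous.measurable
  have htm := truncB_meas (V := EuclideanSpace ℝ (Fin d))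
  -- bounded differences in the noise
  have hdiff : ∀ (z x : Fin n → EuclideanSpace ℝ (Fin d)) (j : Fin n)
      (y : EuclideanSpace ℝ (Fin d)),
      |K (fun i => z i + ε • truncB (x i))
        - K (fun i => z i + ε • truncB (Function.update x j y i))| ≤ 2 * ε * L j := by
    intro z x j y
    have e : (fun i => z i + ε • truncB (Function.update x j y i))
        = Function.update (fun i => z i + ε • truncB (x i)) j (z j + ε • truncB y) := by
      funext i
      by_cases hij : i = j
      · subst hij; simp
      · simp [hij]
    rw [e]
    refine (hK _ _ _).trans ?_
    have hd : dist (z j + ε • truncB (x j)) (z j + ε • truncB y) ≤ 2 * ε := by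
      rw [dist_add_left, dist_eq_norm, ← smul_sub, norm_smul, Real.norm_eq_abs, abs_of_pos hε]
      have := norm_sub_le (truncB (x j)) (truncB y)
      have h1 := truncB_norm (x j)
      have h2 := truncB_norm y
      nlinarith
    calc _ ≤ L j * (2 * ε) := mul_le_mul_of_nonneg_left hd (hL j)
      _ = _ := by ring
  have hxm : ∀ z : Fin n → EuclideanSpace ℝ (Fin d),
      Measurable (fun x : Fin n → EuclideanSpace ℝ (Fin d) =>
        K (fun i => z i + ε • truncB (x i))) := by
    intro z
    refine hKm.comp (measurable_pi_iff.2 fun i => ?_)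
    exact ((htm.comp (measurable_pi_apply i)).const_smul ε).const_add (z i)
  have hxi : ∀ z : Fin n → EuclideanSpace ℝ (Fin d),
      Integrable (fun x : Fin n → EuclideanSpace ℝ (Fin d) =>
        K (fun i => z i + ε • truncB (x i))) ρ := by
    intro z
    obtain ⟨M, hM⟩ := bdd_of_diff _ _ (hdiff z)
    exact Integrable.of_bound (hxm z).aestronglyMeasurable M (Filter.Eventually.of_forall hM)
  -- averaged observable
  set Kt : (Fin n → EuclideanSpace ℝ (Fin d)) → ℝ :=
    fun z => ∫ x, K (fun i => z i + ε • truncB (x i)) ∂ρ with hKt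
  have hKtL : SepLip Kt L := by
    intro z j y
    simp only [hKt]
    rw [← integral_sub (hxi _) (hxi _)]
    have := norm_integral_le_of_norm_le_const (μ := ρ)
      (f := fun x => K (fun i => z i + ε • truncB (x i))
        - K (fun i => Function.update z j y i + ε • truncB (x i))) (C := L j * dist (z j) y)
      (Filter.Eventually.of_forall fun x => by
        have e : (fun i => Function.update z j y i + ε • truncB (x i))
            = Function.update (fun i => z i + ε • truncB (x i)) j (y + ε • truncB (x j)) := by
          funext i
          by_cases hij : i = j
          · subst hij; simp
          · simp [hij]
        rw [e]
        refine (hK _ _ _).trans ?_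
        rw [dist_add_right])
    simpa using this
  have hosc : ∀ (z x : Fin n → EuclideanSpace ℝ (Fin d)), |K (fun i => z i + ε • truncB (x i)) - Kt z| ≤ ∑ j, 2 * ε * L j := by
    intro z x
    have e : K (fun i => z i + ε • truncB (x i)) - Kt z
        = ∫ x', (K (fun i => z i + ε • truncB (x i)) - K (fun i => z i + ε • truncB (x' i))) ∂ρ := by
      rw [integral_sub (integrable_const _) (hxi z)]
      simp [hKt]
    rw [e]
    have := norm_integral_le_of_norm_le_const (μ := ρ)
      (f := fun x' => K (fun i => z i + ε • truncB (x i)) - K (fun i => z i + ε • truncB (x' i)))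
      (C := ∑ j, 2 * ε * L j)
      (Filter.Eventually.of_forall fun x' => tele_bound
        (fun x : Fin n → EuclideanSpace ℝ (Fin d) => K (fun i => z i + ε • truncB (x i)))
        (fun j _ _ => 2 * ε * L j) (hdiff z) x x')
    simpa using this
  -- the orbit map
  have hom : Measurable (fun (x : EuclideanSpace ℝ (Fin d)) (i : Fin n) => T^[(i : ℕ)] x) :=
    measurable_pi_iff.2 fun i => hT.iterate i
  set G : EuclideanSpace ℝ (Fin d) → ℝ := fun x => Kt (fun i => T^[(i : ℕ)] x) with hG
  have hGm : Measurable G := hKtL.continuous.measurable.comp hom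
  have hGb : ∃ M, ∀ x ∈ X, |G x| ≤ M := by
    have hc : IsCompact (Set.univ.pi fun _ : Fin n => X) := isCompact_univ_pi fun _ => hX
    obtain ⟨M, hM⟩ := hc.exists_bound_of_continuousOn hKtL.continuous.continuousOn
    exact ⟨M, fun x hx => hM _ fun i _ => hTX.iterate i hx⟩
  obtain ⟨M, hM⟩ := hGb
  have hXae : ∀ᵐ x ∂μ, x ∈ X := (prob_compl_eq_zero_iff hX.measurableSet).2 hμX
  have hGi : Integrable G μ :=
    Integrable.of_bound hGm.aestronglyMeasurable M (hXae.mono hM)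
  set F : EuclideanSpace ℝ (Fin d) × (Fin n → EuclideanSpace ℝ (Fin d)) → ℝ :=
    fun p => K (fun i => T^[(i : ℕ)] p.1 + ε • truncB (p.2 i)) with hF
  have hFm : Measurable F := by
    refine hKm.comp (measurable_pi_iff.2 fun i => ?_)
    exact ((hT.iterate i).comp measurable_fst).add
      ((htm.comp ((measurable_pi_apply i).comp measurable_snd)).const_smul ε)
  have hFGb : ∀ p, |F p - G p.1| ≤ ∑ j, 2 * ε * L j := fun p => hosc _ _
  have hFGi : Integrable (fun p => F p - G p.1) (μ.prod ρ) :=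
    Integrable.of_bound (hFm.sub (hGm.comp measurable_fst)).aestronglyMeasurable _
      (Filter.Eventually.of_forall hFGb)
  have hFi : Integrable F (μ.prod ρ) := by
    have := hFGi.add (hGi.comp_fst ρ)
    refine this.congr (Filter.Eventually.of_forall fun p => ?_)
    simp
  have hEF : ∫ p, F p ∂(μ.prod ρ) = ∫ x, G x ∂μ := by
    rw [integral_prod _ hFi]
  change ∫ p, |F p - ∫ p', F p' ∂(μ.prod ρ)| ^ q ∂(μ.prod ρ) ≤ _
  rw [hEF]
  set m := ∫ x, G x ∂μ with hm
  have hA : Integrable (fun p => |F p - G p.1| ^ q) (μ.prod ρ) := by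
    refine Integrable.of_bound
      ((hFm.sub (hGm.comp measurable_fst)).abs.pow_const q).aestronglyMeasurable
      ((∑ j, 2 * ε * L j) ^ q) (Filter.Eventually.of_forall fun p => ?_)
    rw [Real.norm_eq_abs, abs_of_nonneg (by positivity)]
    exact rpow_le_rpow (abs_nonneg _) (hFGb p) q0.le
  have hB : Integrable (fun x => |G x - m| ^ q) μ := by
    refine Integrable.of_bound
      ((hGm.sub_const m).abs.pow_const q).aestronglyMeasurable
      ((M + |m|) ^ q) (hXae.mono fun x hx => ?_)
    rw [Real.norm_eq_abs, abs_of_nonneg (by positivity)]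
    refine rpow_le_rpow (abs_nonneg _) ?_ q0.le
    have := abs_sub (G x) m
    linarith [hM x hx]
  have hB' := hB.comp_fst ρ
  have hpt : ∀ p, |F p - m| ^ q ≤ 2 ^ q * (|F p - G p.1| ^ q + |G p.1 - m| ^ q) := by
    intro p
    have h1 := abs_sub_le (F p) (G p.1) m
    set a := |F p - G p.1| with ha
    set b := |G p.1 - m| with hb
    have ha0 : 0 ≤ a := abs_nonneg _
    have hb0 : 0 ≤ b := abs_nonneg _
    have h2 : |F p - m| ^ q ≤ (2 * max a b) ^ q := rpow_le_rpow (abs_nonneg _)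
      (by linarith [le_max_left a b, le_max_right a b]) q0.le
    rw [mul_rpow (by norm_num) (le_max_of_le_left ha0)] at h2
    refine h2.trans (mul_le_mul_of_nonneg_left ?_ (by positivity))
    have := rpow_nonneg ha0 q
    have := rpow_nonneg hb0 q
    rcases max_choice a b with h | h <;> rw [h] <;> linarith
  have hAle : ∫ p, |F p - G p.1| ^ q ∂(μ.prod ρ)
      ≤ q ^ q * (2 * exp (1 / 2)) * (∑ j, (2 * ε * L j) ^ 2) ^ (q / 2) := by
    rw [integral_prod _ hA]
    have step : ∀ x, ∫ y, |F (x, y) - G x| ^ q ∂ρ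
        ≤ q ^ q * (2 * exp (1 / 2)) * (∑ j, (2 * ε * L j) ^ 2) ^ (q / 2) := fun x =>
      moment_bdd_diff P q q0 n _ _ (hxm (fun i => T^[(i : ℕ)] x))
        (hdiff (fun i => T^[(i : ℕ)] x))
    calc _ ≤ ∫ x, q ^ q * (2 * exp (1 / 2)) * (∑ j, (2 * ε * L j) ^ 2) ^ (q / 2) ∂μ :=
          integral_mono_of_nonneg (Filter.Eventually.of_forall fun x =>
            integral_nonneg fun y => by positivity) (integrable_const _)
            (Filter.Eventually.of_forall step)
      _ = _ := by simp
  have hBle : ∫ p, |G p.1 - m| ^ q ∂(μ.prod ρ) ≤ Cq * (∑ j, L j ^ 2) ^ (q / 2) := by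
    rw [integral_prod _ hB']
    simpa using hconc n hn Kt L hKtL
  calc _ ≤ ∫ p, 2 ^ q * (|F p - G p.1| ^ q + |G p.1 - m| ^ q) ∂(μ.prod ρ) :=
        integral_mono_of_nonneg (Filter.Eventually.of_forall fun x => by positivity)
          ((hA.add hB').const_mul _) (Filter.Eventually.of_forall hpt)
    _ ≤ _ := by
      rw [integral_const_mul, integral_add hA hB']
      exact mul_le_mul_of_nonneg_left (add_le_add hAle hBle) (by positivity)

/-- If the dynamical system `(X,T,μ)` satisfies the polynomial concentration
inequality with moment `q ≥ 2`, then the system observed with i.i.d. noise of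
amplitude `ε` satisfies a polynomial concentration inequality with the same moment,
with constant `D_q (1 + ε)^q`. -/
theorem observed_system_polynomial_concentration {d : ℕ}
    (X : Set (EuclideanSpace ℝ (Fin d))) (hX : IsCompact X)
    (T : EuclideanSpace ℝ (Fin d) → EuclideanSpace ℝ (Fin d))
    (hT : Measurable T) (hTX : Set.MapsTo T X X)
    (μ : Measure (EuclideanSpace ℝ (Fin d))) [IsProbabilityMeasure μ]
    (hμX : μ X = 1) (hinv : μ.map T = μ)
    (q : ℝ) (hq : 2 ≤ q) (Cq : ℝ) (hCq : 0 < Cq)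
    (hconc : ∀ (n : ℕ), 1 ≤ n → ∀ (K : (Fin n → EuclideanSpace ℝ (Fin d)) → ℝ)
      (L : Fin n → ℝ), SepLip K L →
      ∫ x, |K (fun i => T^[(i : ℕ)] x)
          - ∫ z, K (fun i => T^[(i : ℕ)] z) ∂μ| ^ q ∂μ
        ≤ Cq * (∑ j, L j ^ 2) ^ (q / 2))
    (P : Measure (EuclideanSpace ℝ (Fin d))) [IsProbabilityMeasure P]
    (hP : ∀ᵐ ξ ∂P, ‖ξ‖ ≤ 1) :
    ∃ Dq : ℝ, 0 < Dq ∧ ∀ ε : ℝ, 0 < ε → ∀ (n : ℕ), 1 ≤ n →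
      ∀ (K : (Fin n → EuclideanSpace ℝ (Fin d)) → ℝ) (L : Fin n → ℝ), SepLip K L →
      ∫ p, |K (fun i => T^[(i : ℕ)] p.1 + ε • p.2 i)
          - ∫ p', K (fun i => T^[(i : ℕ)] p'.1 + ε • p'.2 i)
              ∂(μ.prod (Measure.pi fun _ : Fin n => P))| ^ q
        ∂(μ.prod (Measure.pi fun _ : Fin n => P))
        ≤ Dq * (1 + ε) ^ q * (∑ j, L j ^ 2) ^ (q / 2) := by
  have q0 : 0 < q := by linarith
  set B := q ^ q * (2 * exp (1 / 2)) with hB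
  have B0 : 0 < B := by positivity
  refine ⟨2 ^ q * (B * 2 ^ q + Cq), by positivity, ?_⟩
  intro ε hε n hn K L hK
  have hae : ∀ᵐ p ∂(μ.prod (Measure.pi fun _ : Fin n => P)),
      K (fun i => T^[(i : ℕ)] p.1 + ε • p.2 i)
        = K (fun i => T^[(i : ℕ)] p.1 + ε • truncB (p.2 i)) := by
    have h1 : ∀ᵐ p ∂(μ.prod (Measure.pi fun _ : Fin n => P)), ∀ i, ‖p.2 i‖ ≤ 1 := by
      rw [ae_all_iff]
      intro i
      exact Measure.quasiMeasurePreserving_snd.ae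
        ((Measure.quasiMeasurePreserving_eval (fun _ : Fin n => P) i).ae hP)
    filter_upwards [h1] with p hp
    congr 1
    funext i
    simp [truncB, hp i]
  have h := core X hX T hT hTX μ hμX q hq Cq hconc P ε hε n hn K _ hK.abs (fun j => abs_nonneg _)
  rw [integral_congr_ae hae]
  have e := integral_congr_ae (μ := μ.prod (Measure.pi fun _ : Fin n => P))
    (hae.mono fun p hp => congrArg (fun t => |t
      - ∫ p', K (fun i => T^[(i : ℕ)] p'.1 + ε • truncB (p'.2 i))
              ∂(μ.prod (Measure.pi fun _ : Fin n => P))| ^ q) hp)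
  rw [e]
  refine h.trans ?_
  simp_rw [mul_pow, sq_abs, ← Finset.mul_sum]
  set S := ∑ j, L j ^ 2 with hS
  have hS0 : 0 ≤ S := Finset.sum_nonneg fun j _ => sq_nonneg _
  have e2 : ((2:ℝ) ^ 2 * ε ^ 2 * S) ^ (q / 2) = 2 ^ q * ε ^ q * S ^ (q / 2) := by
    rw [← mul_pow, mul_rpow (by positivity) hS0, ← rpow_natCast, ← rpow_mul (by positivity),
      mul_rpow (by norm_num) hε.le]
    have : ((2:ℕ):ℝ) * (q / 2) = q := by push_cast; ring
    rw [this]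
  rw [e2, ← hB]
  have h1 : ε ^ q ≤ (1 + ε) ^ q := rpow_le_rpow hε.le (by linarith) q0.le
  have h2 : 1 ≤ (1 + ε) ^ q := one_le_rpow (by linarith) q0.le
  have hSq : 0 ≤ S ^ (q / 2) := rpow_nonneg hS0 _
  calc _ = 2 ^ q * ((B * 2 ^ q) * ε ^ q + Cq * 1) * S ^ (q / 2) := by ring
    _ ≤ 2 ^ q * ((B * 2 ^ q) * (1 + ε) ^ q + Cq * (1 + ε) ^ q) * S ^ (q / 2) := by gcongr
    _ = _ := by ring
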